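/- Fix an integer n ≥ 5, let τ > 0 with t_m = mτ, and let g : [0, t_n] → ℝ be integrable, nonnegative, and nonincreasing. Let c_j^k(s) = ∏_{m=0, m≠j}^{4} (s − t_k + mτ)/((m − j)τ), j = 0,1,2,3,4, be the order-5 Lagrange coefficients. Then for every integer k with 1 ≤ k and k + 4 ≤ n, the combined weight w̃_k^5 = Σ_{j=0}^{4} ∫_{t_{k+j−1}}^{t_{k+j}} c_j^{k+j}(s) g(s) ds is nonnegative. -/

import Mathlib

open Finset MeasureTheory

/-- The order-`γ` Lagrange coefficient `c_j^k(s)` at the node `t_k`, on a uniform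
mesh of step `τ`: `c_j^k(s) = ∏_{m=0, m≠j}^{γ-1} (s - t_k + mτ)/((m - j)τ)`. -/
noncomputable def lagC (γ j : ℕ) (tk τ s : ℝ) : ℝ :=
  ∏ m ∈ (Finset.range γ).erase j, (s - tk + (m : ℝ) * τ) / (((m : ℝ) - (j : ℝ)) * τ)

/-- Lagrange coefficients depend on the evaluation point only through its offset from the node. -/
lemma lagC_add_right (γ j : ℕ) (tk τ s d : ℝ) : lagC γ j (tk + d) τ (s + d) = lagC γ j tk τ s := by
  simp only [lagC, add_sub_add_right_eq_sub]

lemma continuous_lagC (γ j : ℕ) (tk τ : ℝ) : Continuous (lagC γ j tk τ) := by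
  unfold lagC
  fun_prop

lemma lagC_scaled (γ j : ℕ) {τ : ℝ} (hτ : τ ≠ 0) (tk u : ℝ) :
    lagC γ j tk τ (tk + u * τ) =
      ∏ m ∈ (Finset.range γ).erase j, (u + m) / ((m : ℝ) - (j : ℝ)) := by
  unfold lagC
  refine Finset.prod_congr rfl fun m _ => ?_
  rw [show tk + u * τ - tk + (m : ℝ) * τ = (u + m) * τ by ring, mul_div_mul_right _ _ hτ]

/-- On the last mesh interval the order-5 coefficients pair nonnegatively with every
nonnegative nonincreasing finite sequence. -/
lemma sum_lagC_five_mul_nonneg {τ : ℝ} (hτ : τ ≠ 0) (tk : ℝ) {u : ℝ} (hu₁ : -1 ≤ u) (hu₀ : u ≤ 0)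
    {a : ℕ → ℝ} (ha₀ : 0 ≤ a 4) (ha : ∀ j < 4, a (j + 1) ≤ a j) :
    0 ≤ ∑ j ∈ Finset.range 5, lagC 5 j tk τ (tk + u * τ) * a j := by
  have e0 : (Finset.range 5).erase 0 = {1, 2, 3, 4} := by decide
  have e1 : (Finset.range 5).erase 1 = {0, 2, 3, 4} := by decide
  have e2 : (Finset.range 5).erase 2 = {0, 1, 3, 4} := by decide
  have e3 : (Finset.range 5).erase 3 = {0, 1, 2, 4} := by decide
  have e4 : (Finset.range 5).erase 4 = {0, 1, 2, 3} := by decide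
  obtain ⟨v, rfl⟩ : ∃ v, u = -v := ⟨-u, by ring⟩
  have hv₀ : 0 ≤ v := by linarith
  have hv₁ : 0 ≤ 1 - v := by linarith
  have hv₂ : 0 ≤ 2 - v := by linarith
  have hv₃ : 0 ≤ 3 - v := by linarith
  have hv₄ : 0 ≤ 4 - v := by linarith
  have d0 : 0 ≤ a 0 - a 1 := sub_nonneg.2 (ha 0 (by norm_num))
  have d1 : 0 ≤ a 1 - a 2 := sub_nonneg.2 (ha 1 (by norm_num))
  have d2 : 0 ≤ a 2 - a 3 := sub_nonneg.2 (ha 2 (by norm_num))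
  have d3 : 0 ≤ a 3 - a 4 := sub_nonneg.2 (ha 3 (by norm_num))
  have abel : ∑ j ∈ Finset.range 5, lagC 5 j tk τ (tk + -v * τ) * a j =
      (1 - v) * (2 - v) * (3 - v) * (4 - v) / 24 * (a 0 - a 1)
      + (2 - v) * (3 - v) * (4 - v) * (1 + 3 * v) / 24 * (a 1 - a 2)
      + (1 - v * (1 - v) * (2 - v) * (13 - 3 * v) / 24) * (a 2 - a 3)
      + (1 + v * (1 - v) * (2 - v) * (3 - v) / 24) * (a 3 - a 4) + a 4 := by
    simp only [lagC_scaled 5 _ hτ, Finset.sum_range_succ, Finset.sum_range_zero, e0, e1, e2, e3, e4]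
    norm_num [Finset.prod_insert]
    ring
  have q : 0 ≤ 1 - v * (1 - v) * (2 - v) * (13 - 3 * v) / 24 := by
    have h1 : v * (1 - v) ≤ 1 / 4 := by nlinarith [sq_nonneg (2 * v - 1)]
    have h2 : (2 - v) * (13 - 3 * v) ≤ 26 := by nlinarith
    have h3 : 0 ≤ (2 - v) * (13 - 3 * v) := mul_nonneg hv₂ (by linarith)
    nlinarith [mul_le_mul h1 h2 h3 (by norm_num)]
  rw [abel]
  positivity

/-- **stability of the order-5 scheme.** On the uniform mesh `t_m = mτ`,
for a nonnegative nonincreasing integrable `g` on `[0, t_n]` and `1 ≤ k`, `k + 4 ≤ n`,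
the combined weight `w̃_k^5 = ∑_{j=0}^{4} ∫_{t_{k+j-1}}^{t_{k+j}} c_j^{k+j}(s) g(s) ds`
is nonnegative. -/
theorem stmt9 (n : ℕ) (hn : 5 ≤ n) (τ : ℝ) (hτ : 0 < τ)
    (g : ℝ → ℝ) (hg : IntegrableOn g (Set.Icc 0 ((n : ℝ) * τ)))
    (hg0 : ∀ s ∈ Set.Icc (0 : ℝ) ((n : ℝ) * τ), 0 ≤ g s)
    (hgmono : AntitoneOn g (Set.Icc (0 : ℝ) ((n : ℝ) * τ)))
    (k : ℕ) (hk1 : 1 ≤ k) (hk2 : k + 4 ≤ n) :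
    0 ≤ ∑ j ∈ Finset.range 5,
          ∫ s in ((((k + j : ℕ) : ℝ) - 1) * τ)..(((k + j : ℕ) : ℝ) * τ),
            lagC 5 j (((k + j : ℕ) : ℝ) * τ) τ s * g s := by
  have shift : ∀ j : ℕ, ∫ s in ((((k + j : ℕ) : ℝ) - 1) * τ)..(((k + j : ℕ) : ℝ) * τ),
      lagC 5 j (((k + j : ℕ) : ℝ) * τ) τ s * g s =
      ∫ s in (((k : ℝ) - 1) * τ)..((k : ℝ) * τ), lagC 5 j ((k : ℝ) * τ) τ s * g (s + j * τ) := by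
    intro j
    have hk : ((k + j : ℕ) : ℝ) * τ = k * τ + j * τ := by push_cast; ring
    have hk' : (((k + j : ℕ) : ℝ) - 1) * τ = (k - 1) * τ + j * τ := by push_cast; ring
    rw [hk, hk', ← intervalIntegral.integral_comp_add_right]
    simp only [lagC_add_right]
  have hk1' : (1 : ℝ) ≤ k := by exact_mod_cast hk1
  have hk2' : (k : ℝ) + 4 ≤ n := by exact_mod_cast hk2
  have hle : ((k : ℝ) - 1) * τ ≤ k * τ := by nlinarith
  have mem : ∀ j ∈ Finset.range 5, ∀ s ∈ Set.Icc (((k : ℝ) - 1) * τ) (k * τ),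
      s + j * τ ∈ Set.Icc (0 : ℝ) (n * τ) := by
    rintro j hj s ⟨hs₁, hs₂⟩
    have hj' : (j : ℝ) ≤ 4 := by
      exact_mod_cast Nat.le_of_lt_succ (Finset.mem_range.1 hj)
    have h₀ : 0 ≤ ((k : ℝ) - 1) * τ := mul_nonneg (by linarith) hτ.le
    have h₁ : ((k : ℝ) + j) * τ ≤ n * τ := mul_le_mul_of_nonneg_right (by linarith) hτ.le
    exact ⟨add_nonneg (h₀.trans hs₁) (by positivity), by linarith⟩
  have hint : ∀ j ∈ Finset.range 5, IntervalIntegrable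
      (fun s => lagC 5 j ((k : ℝ) * τ) τ s * g (s + j * τ)) volume ((k - 1) * τ) (k * τ) := by
    intro j hj
    refine IntervalIntegrable.continuousOn_mul ?_ (continuous_lagC _ _ _ _).continuousOn
    have h : IntervalIntegrable g volume (((k : ℝ) - 1) * τ + j * τ) (k * τ + j * τ) := by
      rw [intervalIntegrable_iff_integrableOn_Icc_of_le (by linarith)]
      exact hg.mono_set (Set.Icc_subset_Icc (mem j hj _ (Set.left_mem_Icc.2 hle)).1
        (mem j hj _ (Set.right_mem_Icc.2 hle)).2)
    simpa using h.comp_add_right (j * τ)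
  simp only [shift]
  rw [← intervalIntegral.integral_finsetSum hint]
  refine intervalIntegral.integral_nonneg hle fun s hs => ?_
  obtain ⟨u, rfl⟩ : ∃ u, s = k * τ + u * τ := ⟨s / τ - k, by field_simp; ring⟩
  have hu₁ : -1 ≤ u := le_of_mul_le_mul_right (by linarith [hs.1]) hτ
  have hu₀ : u ≤ 0 := le_of_mul_le_mul_right (by linarith [hs.2]) hτ
  refine sum_lagC_five_mul_nonneg hτ.ne' _ hu₁ hu₀
    (a := fun j : ℕ => g (k * τ + u * τ + j * τ)) (hg0 _ (mem 4 (by simp) _ hs)) fun j hj => ?_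
  refine hgmono (mem j (Finset.mem_range.2 (by omega)) _ hs)
    (mem (j + 1) (Finset.mem_range.2 (by omega)) _ hs) ?_
  push_cast
  linarith
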